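/- Let B be a signed chord diagram on n ≥ 2 chords whose intersection graph I(B) is connected, and write ∂ε^×_B(z) = Σ_i a_i z^i. Then the coefficients a_i are nonzero for all 1 ≤ i ≤ n (so that ∂ε^×_B(z) = a₁z + a₂z² + ⋯ + a_n z^n with every a_i ≠ 0) if and only if I(B) is a complete graph, i.e. every pair of distinct chords of B is interlaced. -/

import Mathlib

open Finset Polynomial

/-- A signed chord diagram (bouquet) on a finite chord set `E` with `n` chords:
the `2*n` cyclic positions are labeled by chords via `chord`, each chord occupying
exactly two positions, and each chord carries a sign (`true` = `+1` = untwisted,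
`false` = `-1` = twisted). -/
structure Bouquet (n : ℕ) (E : Type) [Fintype E] [DecidableEq E] where
  chord : Fin (2 * n) → E
  sign : E → Bool
  fiber_two : ∀ e : E, (Finset.univ.filter fun i => chord i = e).card = 2

namespace Bouquet

variable {n : ℕ} {E : Type} [Fintype E] [DecidableEq E]

/-- The partial Petrial `B^{×|A}`: same chord diagram, signs flipped exactly on `A`. -/
def petrial (B : Bouquet n E) (A : Finset E) : Bouquet n E where
  chord := B.chord
  sign := fun e => if e ∈ A then !B.sign e else B.sign e
  fiber_two := B.fiber_two

/-- The boundary graph on the `4*n` points `(i, b)` (with `b = true` meaning `i⁺` and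
`b = false` meaning `i⁻`): the matching `σ` joins `i⁺` to `(i+1)⁻`, and the matching `τ`
joins, for each chord with endpoints `{i, j}`, the points `i⁺,j⁻` and `i⁻,j⁺` when the
sign is `+1`, and the points `i⁺,j⁺` and `i⁻,j⁻` when the sign is `-1`. -/
def boundaryGraph (B : Bouquet n E) : SimpleGraph (Fin (2 * n) × Bool) :=
  SimpleGraph.fromRel fun x y =>
    (x.2 = true ∧ y.2 = false ∧ y.1.val = (x.1.val + 1) % (2 * n)) ∨
    (B.chord x.1 = B.chord y.1 ∧ x.1 ≠ y.1 ∧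
      (if B.sign (B.chord x.1) then x.2 ≠ y.2 else x.2 = y.2))

/-- `f(B)`: the number of boundary components of `B`, i.e. the number of connected
components of the boundary graph. -/
noncomputable def numBoundary (B : Bouquet n E) : ℕ :=
  Nat.card B.boundaryGraph.ConnectedComponent

/-- The Euler genus `ε(B) = n + 1 - f(B)`. -/
noncomputable def eulerGenus (B : Bouquet n E) : ℕ :=
  n + 1 - B.numBoundary

/-- The partial Petrial polynomial `∂ε^×_B(z) = Σ_{A ⊆ E} z^{ε(B^{×|A})}`. -/
noncomputable def petrialPoly (B : Bouquet n E) : Polynomial ℤ :=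
  ∑ A : Finset E, Polynomial.X ^ (B.petrial A).eulerGenus

/-- Two distinct chords are interlaced if exactly one endpoint of the second lies in
one of the two open arcs determined by the endpoints of the first (expressed here by
cutting the circle between positions `2*n - 1` and `0`). -/
def Interlaced (B : Bouquet n E) (e e' : E) : Prop :=
  e ≠ e' ∧ ∃ i j : Fin (2 * n), B.chord i = e ∧ B.chord j = e ∧ i < j ∧
    (Finset.univ.filter fun k => B.chord k = e' ∧ i < k ∧ k < j).card = 1

/-- The intersection graph `I(B)`: vertices are the chords, two chords adjacent iff
interlaced. -/
def intersectionGraph (B : Bouquet n E) : SimpleGraph E :=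
  SimpleGraph.fromRel B.Interlaced

end Bouquet

/-- Functions on the vertices that agree along edges are functions on the connected components. -/
def SimpleGraph.ConnectedComponent.funEquiv {V : Type*} (G : SimpleGraph V) (α : Type*) :
    (G.ConnectedComponent → α) ≃ {g : V → α // ∀ x y, G.Adj x y → g x = g y} where
  toFun f := ⟨fun v => f (G.connectedComponentMk v), fun _ _ h =>
    congrArg f (SimpleGraph.ConnectedComponent.sound h.reachable)⟩
  invFun g := SimpleGraph.ConnectedComponent.lift g.1 fun v w p _ => by
    induction p with
    | nil => rfl
    | cons h p ih => exact (g.2 _ _ h).trans (ih (by simp_all))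
  left_inv f := by
    funext c
    induction c using SimpleGraph.ConnectedComponent.ind
    rfl
  right_inv g := rfl

namespace Bouquet

variable {n : ℕ} {E : Type} [Fintype E] [DecidableEq E] (B : Bouquet n E)

lemma exists_endpoints (e : E) : ∃ p : Fin (2 * n) × Fin (2 * n),
    p.1 < p.2 ∧ ∀ i, B.chord i = e ↔ i = p.1 ∨ i = p.2 := by
  obtain ⟨a, b, hab, h⟩ := Finset.card_eq_two.mp (B.fiber_two e)
  have h' : ∀ i, B.chord i = e ↔ i = a ∨ i = b := fun i => by
    have := Finset.ext_iff.mp h i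
    simpa using this
  rcases lt_or_gt_of_ne hab with hlt | hlt
  · exact ⟨(a, b), hlt, h'⟩
  · exact ⟨(b, a), hlt, fun i => (h' i).trans or_comm⟩

/-- The first endpoint of a chord. -/
noncomputable def lo (e : E) : Fin (2 * n) := (B.exists_endpoints e).choose.1

/-- The second endpoint of a chord. -/
noncomputable def hi (e : E) : Fin (2 * n) := (B.exists_endpoints e).choose.2

lemma lo_lt_hi (e : E) : B.lo e < B.hi e := (B.exists_endpoints e).choose_spec.1

lemma chord_eq_iff {e : E} {i : Fin (2 * n)} : B.chord i = e ↔ i = B.lo e ∨ i = B.hi e :=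
  (B.exists_endpoints e).choose_spec.2 i

@[simp] lemma chord_lo (e : E) : B.chord (B.lo e) = e := B.chord_eq_iff.2 (Or.inl rfl)

@[simp] lemma chord_hi (e : E) : B.chord (B.hi e) = e := B.chord_eq_iff.2 (Or.inr rfl)

lemma card_chords (B : Bouquet n E) : Fintype.card E = n := by
  have h := Finset.card_eq_sum_card_fiberwise (f := B.chord) (s := Finset.univ)
    (t := Finset.univ) (fun _ _ => Finset.mem_coe.2 (Finset.mem_univ _))
  simp only [B.fiber_two, Finset.card_univ, Fintype.card_fin, Finset.sum_const, smul_eq_mul] at h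
  omega

lemma sum_chord_eq {M : Type*} [AddCommMonoid M] (e : E) (f : Fin (2 * n) → M) :
    ∑ i with B.chord i = e, f i = f (B.lo e) + f (B.hi e) := by
  have : (Finset.univ.filter fun i => B.chord i = e) = {B.lo e, B.hi e} := by
    ext i; simp [B.chord_eq_iff]
  rw [this, Finset.sum_pair (B.lo_lt_hi e).ne]

/-- The positions strictly between the endpoints of `e` occupied by `e'`. -/
noncomputable def between (e e' : E) : Finset (Fin (2 * n)) :=
  Finset.univ.filter fun k => B.chord k = e' ∧ B.lo e < k ∧ k < B.hi e

lemma between_self (e : E) : B.between e e = ∅ := by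
  ext k
  simp only [between, Finset.mem_filter, Finset.mem_univ, true_and, Finset.notMem_empty, iff_false,
    B.chord_eq_iff]
  rintro ⟨rfl | rfl, h₁, h₂⟩
  · exact lt_irrefl _ h₁
  · exact lt_irrefl _ h₂

lemma card_between (e e' : E) : (B.between e e').card =
    (if B.lo e < B.lo e' ∧ B.lo e' < B.hi e then 1 else 0) +
      if B.lo e < B.hi e' ∧ B.hi e' < B.hi e then 1 else 0 := by
  rw [between, ← Finset.filter_filter, Finset.card_filter, B.sum_chord_eq]

lemma interlaced_iff {e e' : E} : B.Interlaced e e' ↔ e ≠ e' ∧ (B.between e e').card = 1 := by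
  refine and_congr_right fun _ => ⟨?_, fun h => ⟨B.lo e, B.hi e, by simp, by simp, B.lo_lt_hi e, h⟩⟩
  rintro ⟨i, j, hi, hj, hij, h⟩
  have := B.lo_lt_hi e
  rcases B.chord_eq_iff.1 hi with rfl | rfl <;> rcases B.chord_eq_iff.1 hj with rfl | rfl
  · exact absurd hij (lt_irrefl _)
  · exact h
  · exact absurd hij this.asymm
  · exact absurd hij (lt_irrefl _)

lemma Interlaced.symm {B : Bouquet n E} {e e' : E} (h : B.Interlaced e e') :
    B.Interlaced e' e := by
  rw [interlaced_iff, card_between] at h ⊢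
  have h₁ := B.lo_lt_hi e
  have h₂ := B.lo_lt_hi e'
  have hne : ∀ i j, B.chord i = e → B.chord j = e' → i ≠ j := by
    rintro i _ hi hj rfl
    exact h.1 (hi.symm.trans hj)
  have a₁ := hne (B.lo e) (B.lo e') (by simp) (by simp)
  have a₂ := hne (B.lo e) (B.hi e') (by simp) (by simp)
  have a₃ := hne (B.hi e) (B.lo e') (by simp) (by simp)
  have a₄ := hne (B.hi e) (B.hi e') (by simp) (by simp)
  refine ⟨h.1.symm, ?_⟩
  have h := h.2
  split_ifs at h ⊢ <;> omega

lemma intersectionGraph_adj {e e' : E} : B.intersectionGraph.Adj e e' ↔ B.Interlaced e e' := by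
  rw [intersectionGraph, SimpleGraph.fromRel_adj]
  exact ⟨fun h => h.2.elim id Interlaced.symm, fun h => ⟨h.1, Or.inl h⟩⟩

/-- The interlacement matrix over `𝔽₂`, with diagonal entry `1` exactly at the twisted chords. -/
noncomputable def interlaceMatrix : Matrix E E (ZMod 2) :=
  Matrix.of (fun e e' => ((B.between e e').card : ZMod 2)) +
    Matrix.diagonal fun e => if B.sign e then 0 else 1

lemma interlaceMatrix_of_ne {e e' : E} (h : e ≠ e') :
    B.interlaceMatrix e e' = (B.between e e').card := by
  simp [interlaceMatrix, h]

lemma interlaceMatrix_self (e : E) : B.interlaceMatrix e e = if B.sign e then 0 else 1 := by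
  simp [interlaceMatrix, between_self]

lemma interlaced_iff_interlaceMatrix {e e' : E} (h : e ≠ e') :
    B.Interlaced e e' ↔ B.interlaceMatrix e e' = 1 := by
  rw [interlaced_iff, B.interlaceMatrix_of_ne h, card_between]
  split_ifs <;> (simp [h]; try decide)

/-- The sum of `x` over the chord labels of the positions before `m`. -/
noncomputable def prefixSum (x : E → ZMod 2) (m : ℕ) : ZMod 2 :=
  ∑ k : Fin (2 * n) with k.val < m, x (B.chord k)

variable (x : E → ZMod 2)

lemma prefixSum_zero : B.prefixSum x 0 = 0 := by simp [prefixSum]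

lemma prefixSum_succ (i : Fin (2 * n)) :
    B.prefixSum x (i + 1) = B.prefixSum x i + x (B.chord i) := by
  have : (Finset.univ.filter fun k : Fin (2 * n) => k.val < i + 1) =
      insert i (Finset.univ.filter fun k : Fin (2 * n) => k.val < i) := by
    ext k
    simp only [Finset.mem_filter, Finset.mem_univ, true_and, Finset.mem_insert, Fin.ext_iff]
    omega
  rw [prefixSum, this, Finset.sum_insert (by simp), add_comm, prefixSum]

lemma sum_fiberwise (p : Fin (2 * n) → Prop) [DecidablePred p] :
    ∑ k with p k, x (B.chord k) =
      ∑ e, ((Finset.univ.filter fun k => B.chord k = e ∧ p k).card : ZMod 2) * x e := by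
  rw [← Finset.sum_fiberwise _ B.chord]
  refine Finset.sum_congr rfl fun e _ => ?_
  rw [Finset.sum_congr rfl (g := fun _ => x e) fun k hk => by rw [(Finset.mem_filter.1 hk).2],
    Finset.sum_const, nsmul_eq_mul, Finset.filter_filter]
  simp only [and_comm]

lemma prefixSum_total : B.prefixSum x (2 * n) = 0 := by
  rw [prefixSum, sum_fiberwise]
  simp only [Fin.is_lt, and_true, B.fiber_two]
  exact Finset.sum_eq_zero fun e _ => by rw [show ((2 : ℕ) : ZMod 2) = 0 from rfl, zero_mul]

lemma prefixSum_hi (e : E) : B.prefixSum x (B.hi e) =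
    B.prefixSum x (B.lo e + 1) + ∑ e', ((B.between e e').card : ZMod 2) * x e' := by
  have h := B.lo_lt_hi e
  have := B.sum_fiberwise x (fun k => B.lo e < k ∧ k < B.hi e)
  simp only [between]
  rw [← this, prefixSum, prefixSum, ← Finset.sum_union]
  · congr 1
    ext k
    simp only [Finset.mem_filter, Finset.mem_univ, true_and, Finset.mem_union]
    omega
  · rw [Finset.disjoint_left]
    intro k
    simp only [Finset.mem_filter, Finset.mem_univ, true_and]
    omega

lemma interlaceMatrix_mulVec (e : E) : (B.interlaceMatrix.mulVec x) e =
    B.prefixSum x (B.hi e) - B.prefixSum x (B.lo e + 1) + (if B.sign e then 0 else x e) := by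
  rw [interlaceMatrix, Matrix.add_mulVec, Pi.add_apply, Matrix.mulVec_diagonal, prefixSum_hi,
    add_sub_cancel_left]
  congr 1
  split_ifs <;> simp

/-- A vertex function is constant along the edges of the boundary graph. -/
def IsBoundaryConstant (g : Fin (2 * n) × Bool → ZMod 2) : Prop :=
  ∀ p q, B.boundaryGraph.Adj p q → g p = g q

lemma isBoundaryConstant_iff {g : Fin (2 * n) × Bool → ZMod 2} :
    B.IsBoundaryConstant g ↔
      (∀ i j : Fin (2 * n), j.val = (i + 1) % (2 * n) → g (i, true) = g (j, false)) ∧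
      ∀ e b, g (B.lo e, b) = g (B.hi e, if B.sign e then !b else b) := by
  constructor
  · refine fun h => ⟨fun i j hij => h _ _ ?_, fun e b => h _ _ ?_⟩
    · rw [boundaryGraph, SimpleGraph.fromRel_adj]
      exact ⟨by simp, Or.inl (Or.inl ⟨rfl, rfl, hij⟩)⟩
    · rw [boundaryGraph, SimpleGraph.fromRel_adj]
      refine ⟨fun h => (B.lo_lt_hi e).ne (congrArg Prod.fst h), Or.inl (Or.inr ⟨by simp,
        (B.lo_lt_hi e).ne, ?_⟩)⟩
      simp only [chord_lo]
      split_ifs <;> simp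
  · rintro ⟨h₁, h₂⟩
    have key : ∀ p q : Fin (2 * n) × Bool,
        ((p.2 = true ∧ q.2 = false ∧ q.1.val = (p.1.val + 1) % (2 * n)) ∨
        (B.chord p.1 = B.chord q.1 ∧ p.1 ≠ q.1 ∧
          (if B.sign (B.chord p.1) then p.2 ≠ q.2 else p.2 = q.2))) → g p = g q := by
      rintro ⟨i, b⟩ ⟨j, c⟩ (⟨hb, hc, hij⟩ | ⟨hij, hne, hs⟩)
      · simp only at hb hc hij
        subst hb hc
        exact h₁ i j hij
      · simp only at hij hne hs
        have hi := B.chord_eq_iff.1 (rfl : B.chord i = B.chord i)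
        have hj := B.chord_eq_iff.1 hij.symm
        have := h₂ (B.chord i)
        generalize B.chord i = e at *
        rcases hi with rfl | rfl <;> rcases hj with rfl | rfl
        · exact absurd rfl hne
        · rw [this]
          clear this h₁ h₂
          split_ifs at hs ⊢ <;> cases b <;> cases c <;> simp_all
        · rw [this]
          clear this h₁ h₂
          split_ifs at hs ⊢ <;> cases b <;> cases c <;> simp_all
        · exact absurd rfl hne
    intro p q hpq
    rw [boundaryGraph, SimpleGraph.fromRel_adj] at hpq
    exact hpq.2.elim (key p q) fun h => (key q p h).symm

/-- The vertex function with value `c` before position `0` and jump `x e` across the ends of `e`. -/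
noncomputable def potential (c : ZMod 2) (p : Fin (2 * n) × Bool) : ZMod 2 :=
  c + B.prefixSum x (if p.2 then p.1 + 1 else p.1)

lemma isBoundaryConstant_potential (c : ZMod 2) :
    B.IsBoundaryConstant (B.potential x c) ↔ B.interlaceMatrix.mulVec x = 0 := by
  rw [B.isBoundaryConstant_iff, funext_iff, and_iff_right]
  · refine forall_congr' fun e => ?_
    have h₁ := B.prefixSum_succ x (B.lo e)
    have h₂ := B.prefixSum_succ x (B.hi e)
    rw [chord_lo] at h₁
    rw [chord_hi] at h₂
    rw [interlaceMatrix_mulVec, Bool.forall_bool]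
    simp only [potential]
    by_cases hs : B.sign e
    all_goals
      simp only [hs, h₁, h₂, Pi.zero_apply, add_right_inj, if_true, Bool.not_true, Bool.not_false,
        Bool.false_eq_true, if_false]
      generalize B.prefixSum x (B.lo e) = u
      generalize B.prefixSum x (B.hi e) = v
      generalize x e = w
      revert u v w
      decide
  · intro i j hij
    simp only [potential, if_true, Bool.false_eq_true, if_false, add_right_inj]
    by_cases h : i.val + 1 = 2 * n
    · rw [hij, h, Nat.mod_self, prefixSum_zero, prefixSum_total]
    · rw [hij, Nat.mod_eq_of_lt (by omega)]

lemma IsBoundaryConstant.eq_potential {B : Bouquet n E} (hn : 0 < n)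
    {g : Fin (2 * n) × Bool → ZMod 2} (hg : B.IsBoundaryConstant g) :
    g = B.potential (fun e => g (B.lo e, true) - g (B.lo e, false))
      (g (⟨0, by omega⟩, false)) := by
  obtain ⟨h₁, h₂⟩ := (B.isBoundaryConstant_iff).1 hg
  set x : E → ZMod 2 := fun e => g (B.lo e, true) - g (B.lo e, false) with hx
  have jump : ∀ i, g (i, true) = g (i, false) + x (B.chord i) := by
    intro i
    have hi := B.chord_eq_iff.1 (rfl : B.chord i = B.chord i)
    have ht := h₂ (B.chord i) true
    have hf := h₂ (B.chord i) false
    simp only [hx]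
    generalize B.chord i = e at *
    rcases hi with rfl | rfl
    · ring
    · rw [ht, hf]
      cases B.sign e
      all_goals
        simp only [if_true, Bool.false_eq_true, if_false, Bool.not_true, Bool.not_false]
        generalize g (B.hi e, true) = u
        generalize g (B.hi e, false) = v
        revert u v
        decide
  have hfalse : ∀ m (hm : m < 2 * n),
      g (⟨m, hm⟩, false) = g (⟨0, by omega⟩, false) + B.prefixSum x m := by
    intro m
    induction m with
    | zero => intro hm; rw [prefixSum_zero, add_zero]
    | succ m ih =>
      intro hm
      rw [← h₁ ⟨m, by omega⟩ ⟨m + 1, hm⟩ (Nat.mod_eq_of_lt hm).symm, jump, ih,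
        B.prefixSum_succ x ⟨m, by omega⟩, add_assoc]
  funext ⟨⟨i, hi⟩, b⟩
  cases b
  · exact hfalse i hi
  · rw [jump, hfalse, add_assoc, potential, if_pos rfl, ← B.prefixSum_succ x ⟨i, hi⟩]

/-- Boundary-constant functions correspond to a base value and a kernel vector of the interlacement
matrix. -/
noncomputable def boundaryConstantEquiv (hn : 0 < n) :
    ZMod 2 × LinearMap.ker B.interlaceMatrix.mulVecLin ≃ {g // B.IsBoundaryConstant g} where
  toFun cx := ⟨B.potential cx.2.1 cx.1, (B.isBoundaryConstant_potential _ _).2 cx.2.2⟩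
  invFun g := (g.1 (⟨0, by omega⟩, false),
    ⟨fun e => g.1 (B.lo e, true) - g.1 (B.lo e, false), by
      refine (B.isBoundaryConstant_potential _ (g.1 (⟨0, by omega⟩, false))).1 ?_
      rw [← g.2.eq_potential hn]
      exact g.2⟩)
  left_inv := by
    rintro ⟨c, x, hx⟩
    refine Prod.ext ?_ (Subtype.ext (funext fun e => ?_))
    · simp [potential, prefixSum_zero]
    · simp [potential, prefixSum_succ]
  right_inv g := Subtype.ext (g.2.eq_potential hn).symm

lemma numBoundary_eq (hn : 0 < n) :
    B.numBoundary = Module.finrank (ZMod 2) (LinearMap.ker B.interlaceMatrix.mulVecLin) + 1 := by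
  have h := Nat.card_congr ((B.boundaryConstantEquiv hn).trans
    (SimpleGraph.ConnectedComponent.funEquiv B.boundaryGraph (ZMod 2)).symm)
  rw [Nat.card_prod, Module.natCard_eq_pow_finrank (K := ZMod 2)
    (V := LinearMap.ker B.interlaceMatrix.mulVecLin), Nat.card_fun, Nat.card_zmod, ← pow_succ'] at h
  exact (Nat.pow_right_injective le_rfl h).symm

/-- The Euler genus is the rank of the interlacement matrix over `𝔽₂`. -/
lemma eulerGenus_eq_rank (hn : 0 < n) : B.eulerGenus = B.interlaceMatrix.rank := by
  have h := LinearMap.finrank_range_add_finrank_ker B.interlaceMatrix.mulVecLin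
  rw [Module.finrank_fintype_fun_eq_card, B.card_chords] at h
  rw [eulerGenus, B.numBoundary_eq hn, Matrix.rank]
  omega

lemma coeff_petrialPoly_ne_zero_iff {i : ℕ} :
    B.petrialPoly.coeff i ≠ 0 ↔ ∃ A, (B.petrial A).eulerGenus = i := by
  simp only [petrialPoly, Polynomial.finsetSum_coeff, Polynomial.coeff_X_pow, Finset.sum_boole,
    ne_eq, Nat.cast_eq_zero, Finset.card_eq_zero, Finset.filter_eq_empty_iff]
  simp [eq_comm]

lemma exists_petrial_sign (s : E → Bool) : ∃ A, (B.petrial A).sign = s := by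
  refine ⟨Finset.univ.filter fun e => B.sign e ≠ s e, funext fun e => ?_⟩
  simp only [petrial, Finset.mem_filter, Finset.mem_univ, true_and]
  cases B.sign e <;> cases s e <;> rfl

lemma interlaceMatrix_eq_one_of_rank_le_one (hconn : B.intersectionGraph.Connected)
    [Nontrivial E] (h : B.interlaceMatrix.rank ≤ 1) {e e' : E} :
    B.interlaceMatrix e e' = 1 := by
  obtain ⟨⟨u, _⟩, hu⟩ := finrank_le_one_iff.1 h
  have entry : ∀ e', ∃ c, ∀ e, B.interlaceMatrix e e' = c * u e := fun e' => by
    obtain ⟨c, hc⟩ := hu ⟨_, LinearMap.mem_range_self _ (Pi.single e' 1)⟩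
    refine ⟨c, fun e => ?_⟩
    have := congrFun (congrArg Subtype.val hc) e
    simpa using this.symm
  choose v hv using entry
  have one : ∀ e, v e = 1 ∧ u e = 1 := fun e => by
    obtain ⟨e', he⟩ := hconn.preconnected.exists_adj_of_nontrivial e
    have hi := B.intersectionGraph_adj.1 he
    have h₁ := (B.interlaced_iff_interlaceMatrix he.ne).1 hi
    have h₂ := (B.interlaced_iff_interlaceMatrix he.ne').1 hi.symm
    rw [hv] at h₁ h₂
    revert h₁ h₂
    generalize v e = a, u e = b, v e' = c, u e' = d
    revert a b c d
    decide
  rw [hv, (one e').1, (one e).2, one_mul]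

end Bouquet

lemma Matrix.rank_add_le {m n K : Type*} [Fintype n] [Finite m] [Field K] (M N : Matrix m n K) :
    (M + N).rank ≤ M.rank + N.rank := by
  rw [Matrix.rank, Matrix.mulVecLin_add]
  exact (Submodule.finrank_mono (LinearMap.range_add_le _ _)).trans
    (Submodule.finrank_add_le_finrank_add_finrank _ _)

/-- The all-ones matrix over `𝔽₂` plus the diagonal indicator of a proper subset `S` has rank
`|S| + 1`. -/
lemma Matrix.rank_ones_add_diagonal {E : Type*} [Fintype E] [DecidableEq E] (S : Finset E)
    (hS : S ≠ Finset.univ) :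
    (Matrix.of (fun _ _ => 1) + Matrix.diagonal fun e => if e ∈ S then 1 else 0 :
      Matrix E E (ZMod 2)).rank = S.card + 1 := by
  obtain ⟨e₀, he₀⟩ : ∃ e₀, e₀ ∉ S := by
    by_contra! h
    exact hS (Finset.eq_univ_iff_forall.2 h)
  have rank_diag : ∀ T : Finset E,
      (Matrix.diagonal fun e => if e ∈ T then (1 : ZMod 2) else 0).rank = T.card := fun T => by
    rw [Matrix.rank_diagonal, Fintype.card_subtype]
    simp
  apply le_antisymm
  · refine (Matrix.rank_add_le _ _).trans ?_
    rw [rank_diag, add_comm]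
    refine Nat.add_le_add_left ?_ _
    have : (Matrix.of (fun _ _ => 1) : Matrix E E (ZMod 2)) =
        Matrix.vecMulVec (fun _ => 1) (fun _ => 1) := by
      ext; simp [Matrix.vecMulVec]
    rw [this]
    exact Matrix.rank_vecMulVec_le _ _
  · set T : Finset E := Finset.univ.erase e₀
    have hST : S ⊆ T := fun e he => Finset.mem_erase.2 ⟨fun h => he₀ (h ▸ he), Finset.mem_univ _⟩
    have full : (Matrix.of (fun _ _ => 1) + Matrix.diagonal fun e => if e ∈ T then 1 else 0 :
        Matrix E E (ZMod 2)).rank = Fintype.card E := by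
      refine Matrix.rank_of_isUnit _ (Matrix.mulVec_injective_iff_isUnit.1 ?_)
      rw [← Matrix.coe_mulVecLin, ← LinearMap.ker_eq_bot, LinearMap.ker_eq_bot']
      intro x hx
      have row : ∀ e, ∑ k, x k + (if e ∈ T then x e else 0) = 0 := fun e => by
        have := congrFun hx e
        rw [Matrix.mulVecLin_apply, Matrix.add_mulVec, Pi.add_apply, Matrix.mulVec_diagonal] at this
        simpa [Matrix.mulVec, dotProduct] using this
      have hsum : ∑ k, x k = 0 := by simpa [T] using row e₀
      have hx₀ : ∀ e, e ≠ e₀ → x e = 0 := fun e he => by simpa [T, he, hsum] using row e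
      funext e
      by_cases he : e = e₀
      · rwa [Fintype.sum_eq_single e₀ hx₀, ← he] at hsum
      · exact hx₀ e he
    have split : (Matrix.of (fun _ _ => 1) + Matrix.diagonal fun e => if e ∈ T then 1 else 0 :
        Matrix E E (ZMod 2)) = (Matrix.of (fun _ _ => 1) +
          Matrix.diagonal fun e => if e ∈ S then 1 else 0) +
          Matrix.diagonal fun e => if e ∈ T \ S then 1 else 0 := by
      rw [add_assoc, Matrix.diagonal_add]
      congr 2
      funext e
      by_cases h : e ∈ S
      · simp [h, hST h]
      · simp [h]
    have le := Matrix.rank_add_le (Matrix.of (fun _ _ => 1) +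
      Matrix.diagonal fun e => if e ∈ S then 1 else 0 : Matrix E E (ZMod 2))
      (Matrix.diagonal fun e => if e ∈ T \ S then 1 else 0)
    rw [← split, full, rank_diag, Finset.card_sdiff_of_subset hST] at le
    have hT : T.card = Fintype.card E - 1 := by
      rw [Finset.card_erase_of_mem (Finset.mem_univ _), Finset.card_univ]
    have := Finset.card_le_card hST
    have : 0 < Fintype.card E := Fintype.card_pos_iff.2 ⟨e₀⟩
    omega

/-- For a bouquet on `n ≥ 2` chords with connected intersection graph, the partial
Petrial polynomial equals `a₁z + a₂z² + ⋯ + a_nz^n` with all `a_i ≠ 0` (i.e. its nonzero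
coefficients are exactly those in degrees `1,…,n`) iff the intersection graph is
complete, i.e. every pair of distinct chords is interlaced. -/
theorem stmt8 {n : ℕ} (hn : 2 ≤ n) {E : Type} [Fintype E] [DecidableEq E]
    (B : Bouquet n E) (hconn : B.intersectionGraph.Connected) :
    (∀ i : ℕ, B.petrialPoly.coeff i ≠ 0 ↔ (1 ≤ i ∧ i ≤ n)) ↔
      (∀ e e' : E, e ≠ e' → B.Interlaced e e') := by
  have hn₀ : 0 < n := by omega
  have : Nontrivial E := Fintype.one_lt_card_iff_nontrivial.1 (by rw [B.card_chords]; omega)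
  simp only [B.coeff_petrialPoly_ne_zero_iff]
  constructor
  · intro h e e' hne
    obtain ⟨A, hA⟩ := (h 1).2 ⟨le_rfl, by omega⟩
    rw [Bouquet.eulerGenus_eq_rank _ hn₀] at hA
    exact ((B.petrial A).interlaced_iff_interlaceMatrix hne).2
      ((B.petrial A).interlaceMatrix_eq_one_of_rank_le_one hconn hA.le)
  · intro h i
    have offDiag : ∀ A {e e' : E}, e ≠ e' → (B.petrial A).interlaceMatrix e e' = 1 :=
      fun A e e' hne => ((B.petrial A).interlaced_iff_interlaceMatrix hne).1 (h e e' hne)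
    constructor
    · rintro ⟨A, rfl⟩
      rw [Bouquet.eulerGenus_eq_rank _ hn₀]
      refine ⟨Nat.one_le_iff_ne_zero.2 fun h₀ => ?_, ?_⟩
      · obtain ⟨e, e', hne⟩ := exists_pair_ne E
        rw [Matrix.rank, Submodule.finrank_eq_zero, LinearMap.range_eq_bot] at h₀
        have := congrFun (LinearMap.congr_fun h₀ (Pi.single e' 1)) e
        rw [Matrix.mulVecLin_apply, Matrix.mulVec_single_one, Matrix.col_apply, offDiag A hne] at this
        exact one_ne_zero this
      · exact (Matrix.rank_le_card_width _).trans_eq B.card_chords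
    · rintro ⟨h₁, h₂⟩
      obtain ⟨S, hS⟩ : ∃ S : Finset E, S.card = i - 1 := by
        obtain ⟨S, -, hS⟩ := Finset.exists_subset_card_eq (s := (Finset.univ : Finset E))
          (n := i - 1) (by rw [Finset.card_univ, B.card_chords]; omega)
        exact ⟨S, hS⟩
      obtain ⟨A, hA⟩ := B.exists_petrial_sign fun e => decide (e ∈ S)
      refine ⟨A, ?_⟩
      have hM : (B.petrial A).interlaceMatrix =
          Matrix.of (fun _ _ => 1) + Matrix.diagonal fun e => if e ∈ S then 1 else 0 := by
        ext e e'
        by_cases hne : e = e'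
        · subst hne
          rw [Bouquet.interlaceMatrix_self, hA]
          by_cases he : e ∈ S <;> simp [he]
          decide
        · rw [offDiag A hne]
          simp [hne]
      rw [Bouquet.eulerGenus_eq_rank _ hn₀, hM, Matrix.rank_ones_add_diagonal, hS]
      · omega
      · rintro rfl
        rw [Finset.card_univ, B.card_chords] at hS
        omega
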